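/- Let β ≥ 0, σ > 0 and μ ∈ ℝ. Define u_β(x, m) = ((x − m)/σ²)·(√(2π)·σ)^(−β)·exp(−β·(x − m)²/(2σ²)). Then ∫_ℝ (∂/∂m u_β(x, m))|_{m = μ} · φ_{μ,σ}(x) dx = −1/((2π)^(β/2)·σ^(β+2)·(β+1)^(3/2)). -/

import Mathlib

open MeasureTheory Real

theorem integrable_sq_mul_exp_neg_mul_sq {b : ℝ} (hb : 0 < b) :
    Integrable fun x : ℝ => x ^ 2 * Real.exp (-b * x ^ 2) := by
  simpa using integrable_rpow_mul_exp_neg_mul_sq hb (s := 2) (by norm_num)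

theorem integral_sq_mul_exp_neg_mul_sq {b : ℝ} (hb : 0 < b) :
    ∫ x : ℝ, x ^ 2 * Real.exp (-b * x ^ 2) = √(π / b) / (2 * b) := by
  have hderiv (x : ℝ) : HasDerivAt (fun y : ℝ => y * Real.exp (-b * y ^ 2))
      (Real.exp (-b * x ^ 2) - 2 * b * (x ^ 2 * Real.exp (-b * x ^ 2))) x := by
    convert! (hasDerivAt_id x).mul (((hasDerivAt_id x).pow 2).const_mul (-b)).exp using 1
    simp
    ring
  have hsq := (integrable_sq_mul_exp_neg_mul_sq hb).const_mul (2 * b)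
  have hzero := integral_eq_zero_of_hasDerivAt_of_integrable hderiv
    ((integrable_exp_neg_mul_sq hb).sub hsq) (integrable_mul_exp_neg_mul_sq hb)
  rw [integral_sub (integrable_exp_neg_mul_sq hb) hsq, integral_const_mul,
    integral_gaussian] at hzero
  rw [eq_div_iff (by positivity)]
  linarith

theorem hasDerivAt_location_mul_exp (a b s x m : ℝ) :
    HasDerivAt (fun m : ℝ => (x - m) / s * a * Real.exp (-b * (x - m) ^ 2 / (2 * s)))
      (a * (-1 / s + b / s ^ 2 * (x - m) ^ 2) * Real.exp (-b * (x - m) ^ 2 / (2 * s))) m := by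
  have hsub : HasDerivAt (fun m : ℝ => x - m) (-1) m := (hasDerivAt_id m).const_sub x
  convert! ((hsub.div_const s).mul_const a).mul
    (((hsub.pow 2).const_mul (-b)).div_const (2 * s)).exp using 1
  simp
  ring

/-- In the normal location model with known scale `σ`, the expectation of the
derivative of the β-score `u_β(x,m)` with respect to the location `m`, evaluated
at the true mean `μ`, equals `−J_β(μ) = −((2π)^(β/2)·σ^(β+2)·(β+1)^(3/2))⁻¹`. -/
theorem normal_expected_deriv_beta_score (β μ σ : ℝ) (hβ : 0 ≤ β) (hσ : 0 < σ) :
    ∫ x : ℝ,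
        (deriv
          (fun m : ℝ =>
            ((x - m) / σ ^ 2) * (Real.sqrt (2 * π) * σ) ^ (-β) *
              Real.exp (-β * (x - m) ^ 2 / (2 * σ ^ 2))) μ) *
          ((Real.sqrt (2 * π) * σ)⁻¹ * Real.exp (-(x - μ) ^ 2 / (2 * σ ^ 2)))
      = -1 / ((2 * π) ^ (β / 2) * σ ^ (β + 2) * (β + 1) ^ ((3 : ℝ) / 2)) := by
  have hb : 0 < (β + 1) / (2 * σ ^ 2) := by positivity
  set b := (β + 1) / (2 * σ ^ 2) with hbdef
  set C := (√(2 * π) * σ) ^ (-β) with hC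
  let g : ℝ → ℝ := fun y =>
    C * (√(2 * π) * σ)⁻¹ * (-1 / σ ^ 2) * Real.exp (-b * y ^ 2) +
      C * (√(2 * π) * σ)⁻¹ * (β / (σ ^ 2) ^ 2) * (y ^ 2 * Real.exp (-b * y ^ 2))
  have hintegrand (x : ℝ) :
      (deriv (fun m : ℝ => ((x - m) / σ ^ 2) * C *
          Real.exp (-β * (x - m) ^ 2 / (2 * σ ^ 2))) μ) *
        ((√(2 * π) * σ)⁻¹ * Real.exp (-(x - μ) ^ 2 / (2 * σ ^ 2))) =
      g (x - μ) := by
    have hexp : Real.exp (-b * (x - μ) ^ 2) = Real.exp (-β * (x - μ) ^ 2 / (2 * σ ^ 2)) *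
        Real.exp (-(x - μ) ^ 2 / (2 * σ ^ 2)) := by
      rw [← Real.exp_add, hbdef]
      congr 1
      ring
    rw [(hasDerivAt_location_mul_exp C β (σ ^ 2) x μ).deriv]
    simp only [g, hexp]
    ring
  refine ((integral_congr_ae (.of_forall hintegrand)).trans
    (integral_sub_right_eq_self g μ)).trans ?_
  rw [integral_add ((integrable_exp_neg_mul_sq hb).const_mul _)
      ((integrable_sq_mul_exp_neg_mul_sq hb).const_mul _),
    integral_const_mul, integral_const_mul, integral_gaussian,
    integral_sq_mul_exp_neg_mul_sq hb]
  have hβ1 : 0 < β + 1 := by positivity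
  have hsqrt : √(π / b) = √(2 * π) * σ / √(β + 1) := by
    rw [hbdef, show π / ((β + 1) / (2 * σ ^ 2)) = 2 * π * σ ^ 2 / (β + 1) by field_simp,
      Real.sqrt_div (by positivity), Real.sqrt_mul (by positivity), Real.sqrt_sq hσ.le]
  have hCval : C = ((2 * π) ^ (β / 2) * σ ^ β)⁻¹ := by
    rw [hC, Real.rpow_neg (by positivity), Real.mul_rpow (by positivity) hσ.le,
      Real.sqrt_eq_rpow, ← Real.rpow_mul (by positivity)]
    ring_nf
  have hpow : (β + 1) ^ ((3 : ℝ) / 2) = (β + 1) * √(β + 1) := by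
    rw [show (3 : ℝ) / 2 = 1 + 1 / 2 by norm_num, Real.rpow_add hβ1, Real.rpow_one,
      Real.sqrt_eq_rpow]
  have hσpow : σ ^ (β + 2) = σ ^ β * σ ^ 2 := by
    rw [Real.rpow_add hσ, Real.rpow_two]
  have hπ : 0 < √(2 * π) := by positivity
  have hroot : 0 < √(β + 1) := by positivity
  rw [hsqrt, hCval, hpow, hσpow, hbdef]
  field_simp
  ring
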